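/- arXiv:hep-th/0504006 — 5 statements merged into one kernel-verified Lean document; each statement's English description precedes it below -/
import Mathlib

section
/- Let k be a nonnegative integer, set K := k+6 and M := K/gcd(K,60). Define the map J on pairs of integers by J(x,y) := (K-4-2x-y, 3x+y+3-K) (this is the action of the simple current J of A2 on finite Dynkin labels of level-(k+2) G2 integral weights, transported through the identification of Cartan subalgebras). Then for all integers x, y, the integer 120·M divides P(J(x,y)) - P(x,y), and 120·M divides P(J(J(x,y))) - P(x,y). Equivalently, dim_{G2}(J a') ≡ dim_{G2}(J² a') ≡ dim_{G2}(a') (mod M) for every level-(k+2) G2 integral weight a'. -/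
/-- `P x y` is 120 times the formal `G₂` Weyl dimension of the integral weight
with `G₂` Dynkin labels `(x, y)`. -/
def P (x y : ℤ) : ℤ :=
  (x + 1) * (y + 1) * (x + y + 2) * (2 * x + y + 3) * (3 * x + y + 4) * (3 * x + 2 * y + 5)

/-- The action of the `A₂` simple current `J` on the finite Dynkin labels of
level-`(k+2)` `G₂` integral weights, where `K = k + 6`. -/
def Jcur (K x y : ℤ) : ℤ × ℤ := (K - 4 - 2 * x - y, 3 * x + y + 3 - K)

/-- The quotient `(P (J (x, y)) - P (x, y)) / K` in the shifted variables `a = x+1`, `b = y+1`. -/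
def quotQ {R : Type*} [CommRing R] (K a b : R) : R :=
  a * (-((3*a+b)*(a+b)*(3*a+2*b)*b) + (K-(2*a+b))*(a+b)*(3*a+2*b)*b
    + (K-(2*a+b))*((3*a+b)-K)*(3*a+2*b)*b
    - 2*(K-(2*a+b))*((3*a+b)-K)*(K-(a+b))*b
    + (K-(2*a+b))*((3*a+b)-K)*(K-(a+b))*(2*K-(3*a+2*b)))

lemma quotQ_cast (n : ℕ) (K a b : ℤ) :
    ((quotQ K a b : ℤ) : ZMod n) = quotQ (K : ZMod n) (a : ZMod n) (b : ZMod n) := by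
  simp [quotQ]

set_option maxRecDepth 100000 in
lemma quotQ_eight : ∀ K a b : ZMod 8,
    4 * quotQ K a b = 0 ∧ (4 * K ≠ 0 → quotQ K a b = 0) ∧ (2 * K ≠ 0 → 2 * quotQ K a b = 0) := by
  unfold quotQ
  decide +kernel

lemma quotQ_three : ∀ K a b : ZMod 3, K ≠ 0 → quotQ K a b = 0 := by
  unfold quotQ
  decide +kernel

lemma quotQ_five : ∀ K a b : ZMod 5, K ≠ 0 → quotQ K a b = 0 := by
  unfold quotQ
  decide +kernel

lemma g_quotQ (K a b : ℤ) : (120 : ℤ) ∣ (Int.gcd K 60 : ℤ) * quotQ K a b := by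
  have h3 : (3 : ℤ) ∣ (Int.gcd K 60 : ℤ) * quotQ K a b := by
    by_cases h : (3 : ℤ) ∣ K
    · exact (Int.dvd_coe_gcd h (by norm_num)).mul_right _
    · refine Dvd.dvd.mul_left ((ZMod.intCast_zmod_eq_zero_iff_dvd _ 3).1 ?_) _
      rw [quotQ_cast]
      exact quotQ_three _ _ _ fun h' => h ((ZMod.intCast_zmod_eq_zero_iff_dvd _ 3).1 h')
  have h5 : (5 : ℤ) ∣ (Int.gcd K 60 : ℤ) * quotQ K a b := by
    by_cases h : (5 : ℤ) ∣ K
    · exact (Int.dvd_coe_gcd h (by norm_num)).mul_right _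
    · refine Dvd.dvd.mul_left ((ZMod.intCast_zmod_eq_zero_iff_dvd _ 5).1 ?_) _
      rw [quotQ_cast]
      exact quotQ_five _ _ _ fun h' => h ((ZMod.intCast_zmod_eq_zero_iff_dvd _ 5).1 h')
  have h8 : (8 : ℤ) ∣ (Int.gcd K 60 : ℤ) * quotQ K a b := by
    obtain ⟨q4, q1, q2⟩ := quotQ_eight K a b
    rw [← quotQ_cast] at q4 q1 q2
    have e4 : (8 : ℤ) ∣ 4 * quotQ K a b :=
      (ZMod.intCast_zmod_eq_zero_iff_dvd _ 8).1 (by push_cast; exact q4)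
    by_cases h : (4 : ℤ) ∣ K
    · exact e4.trans (mul_dvd_mul_right (Int.dvd_coe_gcd h (by norm_num)) _)
    by_cases h2 : (2 : ℤ) ∣ K
    · have e2 : (8 : ℤ) ∣ 2 * quotQ K a b := by
        refine (ZMod.intCast_zmod_eq_zero_iff_dvd _ 8).1 ?_
        push_cast
        refine q2 fun h' => h ?_
        have : (8 : ℤ) ∣ 2 * K := (ZMod.intCast_zmod_eq_zero_iff_dvd _ 8).1 (by push_cast; exact h')
        omega
      exact e2.trans (mul_dvd_mul_right (Int.dvd_coe_gcd h2 (by norm_num)) _)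
    · refine Dvd.dvd.mul_left ((ZMod.intCast_zmod_eq_zero_iff_dvd _ 8).1 ?_) _
      refine q1 fun h' => h2 ?_
      have : (8 : ℤ) ∣ 4 * K := (ZMod.intCast_zmod_eq_zero_iff_dvd _ 8).1 (by push_cast; exact h')
      omega
  omega

lemma P_Jcur_sub (K x y : ℤ) :
    P (Jcur K x y).1 (Jcur K x y).2 - P x y = K * quotQ K (x + 1) (y + 1) := by
  simp only [P, Jcur, quotQ]
  ring

lemma dvd_P_Jcur_sub (K x y : ℤ) :
    120 * (K / (Int.gcd K 60 : ℤ)) ∣ P (Jcur K x y).1 (Jcur K x y).2 - P x y := by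
  rw [P_Jcur_sub]
  have hg : K / (Int.gcd K 60 : ℤ) * (Int.gcd K 60 : ℤ) = K :=
    Int.ediv_mul_cancel (Int.gcd_dvd_left ..)
  have h := mul_dvd_mul_left (K / (Int.gcd K 60 : ℤ)) (g_quotQ K (x + 1) (y + 1))
  rwa [← mul_assoc, hg, mul_comm _ (120 : ℤ)] at h

/-- The formal `G₂` Weyl dimension is invariant mod `M_{G₂}` under the
`A₂` simple current `J` and its square. -/
theorem G2_dim_invariant_under_simple_current (k : ℕ) (K M : ℤ)
    (hK : K = (k : ℤ) + 6) (hM : M = K / (Int.gcd K 60 : ℤ)) :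
    ∀ x y : ℤ,
      (120 * M ∣ P (Jcur K x y).1 (Jcur K x y).2 - P x y) ∧
      (120 * M ∣
        P (Jcur K (Jcur K x y).1 (Jcur K x y).2).1
          (Jcur K (Jcur K x y).1 (Jcur K x y).2).2 - P x y) := by
  intro x y
  subst hM
  refine ⟨dvd_P_Jcur_sub K x y, ?_⟩
  have h := dvd_add (dvd_P_Jcur_sub K (Jcur K x y).1 (Jcur K x y).2) (dvd_P_Jcur_sub K x y)
  rwa [sub_add_sub_cancel] at h
end

section
/- Let k be a nonnegative integer and set M := (k+6)/gcd(k+6,60). Define Q(a1,a2) := (a2-a1)(a2+1)(a1+2a2+3)(a1+a2+2)(2a1+a2+3)(a1+1), so that Q(a1,a2) = P(a1, a2-a1-1) is 120 times the formal G2 Weyl dimension of the G2 weight corresponding, via the Cartan subalgebra identification, to the level-(k+3) A2 weight (a0; a1, a2) with a0 = k+3-a1-a2. If the integers a1, a2 satisfy a1 = a2, or 2a1+a2 = k+3, or a1+2a2 = k+3 (i.e. the A2 weight (a0; a1, a2) satisfies C b'' = J^i b'' for the A2 charge conjugation C and some power J^i of the A2 simple current), then 120·M divides Q(a1,a2). Equivalently,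 dim_{G2}(b') ≡ 0 (mod M) for every such G2 integral weight b'. -/
/-- `Q a1 a2` is 120 times the formal `G₂` Weyl dimension of the `G₂` weight
corresponding, via the Cartan subalgebra identification, to the level-`(k+3)`
`A₂` weight `(a0; a1, a2)`; explicitly `Q a1 a2 = P a1 (a2 - a1 - 1)`. -/
def Q (a1 a2 : ℤ) : ℤ :=
  (a2 - a1) * (a2 + 1) * (a1 + 2 * a2 + 3) * (a1 + a2 + 2) * (2 * a1 + a2 + 3) * (a1 + 1)

def RR (n x : ℤ) : ℤ := x * (n - x) * (n - 2 * x) * (n - 3 * x) * (2 * n - 3 * x)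

lemma two_dvd_RR (n x : ℤ) : 2 ∣ RR n x := by
  have key : ∀ n x : ZMod 2, x * (n - x) * (n - 2 * x) * (n - 3 * x) * (2 * n - 3 * x) = 0 := by
    decide
  have := key n x
  refine (ZMod.intCast_zmod_eq_zero_iff_dvd _ 2).1 ?_
  simp only [RR]
  push_cast
  exact this

lemma dvd_n_RR (n x : ℤ) : 120 ∣ n * RR n x := by
  have key3 : ∀ n x : ZMod 3,
      n * (x * (n - x) * (n - 2 * x) * (n - 3 * x) * (2 * n - 3 * x)) = 0 := by decide
  have key5 : ∀ n x : ZMod 5,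
      n * (x * (n - x) * (n - 2 * x) * (n - 3 * x) * (2 * n - 3 * x)) = 0 := by decide
  have key8 : ∀ n x : ZMod 8,
      n * (x * (n - x) * (n - 2 * x) * (n - 3 * x) * (2 * n - 3 * x)) = 0 := by decide
  have h3 : (3 : ℤ) ∣ n * RR n x := by
    refine (ZMod.intCast_zmod_eq_zero_iff_dvd _ 3).1 ?_
    simp only [RR]
    push_cast
    exact key3 n x
  have h5 : (5 : ℤ) ∣ n * RR n x := by
    refine (ZMod.intCast_zmod_eq_zero_iff_dvd _ 5).1 ?_
    simp only [RR]
    push_cast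
    exact key5 n x
  have h8 : (8 : ℤ) ∣ n * RR n x := by
    refine (ZMod.intCast_zmod_eq_zero_iff_dvd _ 8).1 ?_
    simp only [RR]
    push_cast
    exact key8 n x
  omega

lemma main_dvd (n x : ℤ) : 120 * (n / (Int.gcd n 60 : ℤ)) ∣ n * RR n x := by
  have hg : (120 : ℤ) ∣ (Int.gcd n 60 : ℤ) * RR n x := by
    rw [Int.gcd_eq_gcd_ab, add_mul]
    refine dvd_add ?_ ?_
    · rw [mul_right_comm]
      exact (dvd_n_RR n x).mul_right _
    · obtain ⟨c, hc⟩ := two_dvd_RR n x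
      rw [hc]
      exact ⟨Int.gcdB n 60 * c, by ring⟩
  have hn : n = (n / (Int.gcd n 60 : ℤ)) * (Int.gcd n 60 : ℤ) :=
    (Int.ediv_mul_cancel (Int.gcd_dvd_left n 60)).symm
  obtain ⟨c, hc⟩ := hg
  refine ⟨c, ?_⟩
  calc n * RR n x = (n / (Int.gcd n 60 : ℤ)) * ((Int.gcd n 60 : ℤ) * RR n x) := by
        rw [← mul_assoc, ← hn]
    _ = _ := by rw [hc]; ring

/-- If the level-`(k+3)` `A₂` weight `(a0; a1, a2)` satisfies `C b'' = Jⁱ b''`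
for charge conjugation `C` and some power of the simple current `J`, then
the corresponding formal `G₂` Weyl dimension vanishes mod `M_{G₂}`. -/
theorem G2_dim_vanishes_on_boundary (k : ℕ) (M : ℤ)
    (hM : M = ((k : ℤ) + 6) / (Int.gcd ((k : ℤ) + 6) 60 : ℤ)) (a1 a2 : ℤ)
    (h : a1 = a2 ∨ 2 * a1 + a2 = (k : ℤ) + 3 ∨ a1 + 2 * a2 = (k : ℤ) + 3) :
    120 * M ∣ Q a1 a2 := by
  subst hM
  rcases h with h | h | h
  · subst h
    simp [Q]
  · have e : Q a1 a2 = ((k : ℤ) + 6) * RR ((k : ℤ) + 6) (a1 + 1) := by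
      have hk : (k : ℤ) = 2 * a1 + a2 - 3 := by omega
      rw [hk, Q, RR]
      ring
    rw [e]
    exact main_dvd _ _
  · have e : Q a1 a2 = -(((k : ℤ) + 6) * RR ((k : ℤ) + 6) (a2 + 1)) := by
      have hk : (k : ℤ) = a1 + 2 * a2 - 3 := by omega
      rw [hk, Q, RR]
      ring
    rw [e]
    exact (main_dvd _ _).neg_right
end

section
/- For every permutation σ of the index set {1,3,4} and all integers a1, a2, a3, a4, permuting the three arguments a1, a3, a4 of R according to σ (leaving a2 fixed) multiplies R by the sign of σ; in particular R(a3,a2,a1,a4) = -R(a1,a2,a3,a4), R(a4,a2,a3,a1) = -R(a1,a2,a3,a4), and R(a1,a2,a4,a3) = -R(a1,a2,a3,a4). Equivalently, for any outer automorphism π of D4 (a permutation of the Dynkin nodes 1, 3, 4), dim_{F4}(π b') = ε(π)·dim_{F4}(b') for every F4 integral weight b', where ε(π) is the parity of π. -/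
/-- `R a1 a2 a3 a4` is `N = 2^15·3^7·5^4·7^2·11` times the formal `F₄` Weyl
dimension of the `F₄` integral weight whose corresponding `D₄` weight has
finite Dynkin labels `b_i = a_i - 1`. -/
def R (a1 a2 a3 a4 : ℤ) : ℤ :=
  a1 * a2 * a3 * a4 * (a1 + a2) * (a1 + a3) * (a1 + a4) * (a2 + a3) * (a2 + a4) *
    (a3 + a4) * (a1 - a3) * (a1 - a4) * (a4 - a3) * (a1 + a2 + a3) * (a1 + a2 + a4) *
    (a2 + a3 + a4) * (a1 + a2 + a3 + a4) * (a1 + 2 * a2 + a3) * (a1 + 2 * a2 + a4) *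
    (2 * a2 + a3 + a4) * (a1 + 2 * a2 + a3 + a4) * (2 * a1 + 2 * a2 + a3 + a4) *
    (a1 + 2 * a2 + 2 * a3 + a4) * (a1 + 2 * a2 + a3 + 2 * a4)

/-- Regrouping of a product of 24 factors into orbits of the `S₃` action. -/
lemma R_eq_orbits (a1 a2 a3 a4 : ℤ) : R a1 a2 a3 a4 =
    a2 * (a1 + a2 + a3 + a4) * (a1 + 2 * a2 + a3 + a4) * (a1 * a3 * a4) *
    ((a1 + a2) * (a2 + a3) * (a2 + a4)) * ((a1 + a3) * (a1 + a4) * (a3 + a4)) *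
    ((a1 + a2 + a3) * (a1 + a2 + a4) * (a2 + a3 + a4)) *
    ((a1 + 2 * a2 + a3) * (a1 + 2 * a2 + a4) * (2 * a2 + a3 + a4)) *
    ((2 * a1 + 2 * a2 + a3 + a4) * (a1 + 2 * a2 + 2 * a3 + a4) *
      (a1 + 2 * a2 + a3 + 2 * a4)) *
    ((a1 - a3) * (a1 - a4) * (a4 - a3)) := by
  unfold R
  ac_rfl

lemma R_swap13 (a1 a2 a3 a4 : ℤ) : R a3 a2 a1 a4 = -R a1 a2 a3 a4 := by
  rw [R_eq_orbits, R_eq_orbits, ← mul_neg]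
  congr 1
  · congr 1
    · congr 1
      · congr 1
        · congr 1
          · congr 1
            · congr 1
              · congr 1
                · ring
                · ring
              · ring
            · ring
          · ring
        · ring
      · ring
    · ring
  · ring

lemma R_swap34 (a1 a2 a3 a4 : ℤ) : R a1 a2 a4 a3 = -R a1 a2 a3 a4 := by
  rw [R_eq_orbits, R_eq_orbits, ← mul_neg]
  congr 1
  · congr 1
    · congr 1
      · congr 1
        · congr 1
          · congr 1
            · congr 1
              · congr 1
                · ring
                · ring
              · ring
            · ring
          · ring
        · ring
      · ring
    · ring
  · ring

lemma R_swap14 (a1 a2 a3 a4 : ℤ) : R a4 a2 a3 a1 = -R a1 a2 a3 a4 := by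
  rw [R_swap13, R_swap34, R_swap13, neg_neg]

lemma R_swap (a2 : ℤ) (x y : Fin 3) (h : x ≠ y) (v : Fin 3 → ℤ) :
    R (v (Equiv.swap x y 0)) a2 (v (Equiv.swap x y 1)) (v (Equiv.swap x y 2)) =
      -R (v 0) a2 (v 1) (v 2) := by
  have h01 := R_swap13 (v 0) a2 (v 1) (v 2)
  have h12 := R_swap34 (v 0) a2 (v 1) (v 2)
  have h02 := R_swap14 (v 0) a2 (v 1) (v 2)
  fin_cases x <;> fin_cases y <;>
    first
    | exact absurd rfl h
    | exact h01
    | exact h12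
    | exact h02

lemma R_perm (a2 : ℤ) (σ : Equiv.Perm (Fin 3)) : ∀ v : Fin 3 → ℤ,
    R (v (σ 0)) a2 (v (σ 1)) (v (σ 2)) =
      (Equiv.Perm.sign σ : ℤ) * R (v 0) a2 (v 1) (v 2) := by
  induction σ using Equiv.Perm.swap_induction_on with
  | one => intro v; simp
  | swap_mul f x y hxy ih =>
    intro v
    have h1 := ih (fun i => v (Equiv.swap x y i))
    have h2 := R_swap a2 x y hxy v
    simp only [Equiv.Perm.mul_apply, Equiv.Perm.sign_mul, Equiv.Perm.sign_swap hxy]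
    rw [h1, h2]
    simp

/-- Permuting the three arguments `a1, a3, a4` of `R` (fixing `a2`) according
to any permutation `σ` multiplies `R` by the sign of `σ`; in particular each
of the three transpositions negates `R`.  Equivalently, for any outer
automorphism `π` of `D₄`, `dim_{F₄}(π b') = ε(π)·dim_{F₄}(b')`. -/
theorem F4_dim_anti_symmetric_under_D4_conjugations :
    (∀ σ : Equiv.Perm (Fin 3), ∀ a1 a2 a3 a4 : ℤ,
      R (![a1, a3, a4] (σ 0)) a2 (![a1, a3, a4] (σ 1)) (![a1, a3, a4] (σ 2)) =
        (Equiv.Perm.sign σ : ℤ) * R a1 a2 a3 a4) ∧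
    (∀ a1 a2 a3 a4 : ℤ, R a3 a2 a1 a4 = -R a1 a2 a3 a4) ∧
    (∀ a1 a2 a3 a4 : ℤ, R a4 a2 a3 a1 = -R a1 a2 a3 a4) ∧
    (∀ a1 a2 a3 a4 : ℤ, R a1 a2 a4 a3 = -R a1 a2 a3 a4) := by
  refine ⟨fun σ a1 a2 a3 a4 => ?_, R_swap13, R_swap14, R_swap34⟩
  exact R_perm a2 σ ![a1, a3, a4]
end

section
/- Let k be a nonnegative integer, set K := k+12, M := K/gcd(K, 27720), and for integers a1, a2, a3, a4 set a0 := K - a1 - 2a2 - a3 - a4 (the shifted zeroth Dynkin label of the corresponding level-(k+6) D4 weight). Then for all integers a1, a2, a3, a4, the integer N·M divides each of the three differences R(a0,a2,a4,a3) - R(a1,a2,a3,a4), R(a3,a2,a1,a0) - R(a1,a2,a3,a4), and R(a4,a2,a0,a1) - R(a1,a2,a3,a4). Equivalently, for every level-(k+3) F4 integral weight b' and each nontrivial simple current J of D4 (J_ν, J_s, J_ν J_s, acting on shifted labels by (a1,a2,a3,a4) ↦ (a0,a2,a4,a3), (a3,a2,a1,a0), (a4,a2,a0,a1) respectively), dim_{F4}(J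 b') ≡ dim_{F4}(b') (mod M). -/
/-- `N = 2^15·3^7·5^4·7^2·11` is the value of `R` at the zero `F₄` weight. -/
def Nf4 : ℤ := 2 ^ 15 * 3 ^ 7 * 5 ^ 4 * 7 ^ 2 * 11

/-- `R` as a product of 24 named factors. -/
lemma R_of (a1 a2 a3 a4 : ℤ) {x0 x1 x2 x3 x4 x5 x6 x7 x8 x9 x10 x11 x12 x13 x14 x15 x16 x17 x18 x19 x20 x21 x22 x23 : ℤ}
    (h0 : a1 = x0)
    (h1 : a2 = x1)
    (h2 : a3 = x2)
    (h3 : a4 = x3)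
    (h4 : a1 + a2 = x4)
    (h5 : a1 + a3 = x5)
    (h6 : a1 + a4 = x6)
    (h7 : a2 + a3 = x7)
    (h8 : a2 + a4 = x8)
    (h9 : a3 + a4 = x9)
    (h10 : a1 - a3 = x10)
    (h11 : a1 - a4 = x11)
    (h12 : a4 - a3 = x12)
    (h13 : a1 + a2 + a3 = x13)
    (h14 : a1 + a2 + a4 = x14)
    (h15 : a2 + a3 + a4 = x15)
    (h16 : a1 + a2 + a3 + a4 = x16)
    (h17 : a1 + 2 * a2 + a3 = x17)
    (h18 : a1 + 2 * a2 + a4 = x18)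
    (h19 : 2 * a2 + a3 + a4 = x19)
    (h20 : a1 + 2 * a2 + a3 + a4 = x20)
    (h21 : 2 * a1 + 2 * a2 + a3 + a4 = x21)
    (h22 : a1 + 2 * a2 + 2 * a3 + a4 = x22)
    (h23 : a1 + 2 * a2 + a3 + 2 * a4 = x23) :
    R a1 a2 a3 a4 = x0 * x1 * x2 * x3 * x4 * x5 * x6 * x7 * x8 * x9 * x10 * x11 * x12 * x13 * x14 * x15 * x16 * x17 * x18 * x19 * x20 * x21 * x22 * x23 := by
  subst_vars; rfl

/-- The Weyl reflection in the direction of the first label. -/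
lemma R_refl (a1 a2 a3 a4 : ℤ) : R (-a1 - 2 * a2 - a3 - a4) a2 a3 a4 = -R a1 a2 a3 a4 := by
  obtain ⟨x0, h0⟩ : ∃ x, a1 = x := ⟨_, rfl⟩
  obtain ⟨x1, h1⟩ : ∃ x, a2 = x := ⟨_, rfl⟩
  obtain ⟨x2, h2⟩ : ∃ x, a3 = x := ⟨_, rfl⟩
  obtain ⟨x3, h3⟩ : ∃ x, a4 = x := ⟨_, rfl⟩
  obtain ⟨x4, h4⟩ : ∃ x, a1 + a2 = x := ⟨_, rfl⟩
  obtain ⟨x5, h5⟩ : ∃ x, a1 + a3 = x := ⟨_, rfl⟩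
  obtain ⟨x6, h6⟩ : ∃ x, a1 + a4 = x := ⟨_, rfl⟩
  obtain ⟨x7, h7⟩ : ∃ x, a2 + a3 = x := ⟨_, rfl⟩
  obtain ⟨x8, h8⟩ : ∃ x, a2 + a4 = x := ⟨_, rfl⟩
  obtain ⟨x9, h9⟩ : ∃ x, a3 + a4 = x := ⟨_, rfl⟩
  obtain ⟨x10, h10⟩ : ∃ x, a1 - a3 = x := ⟨_, rfl⟩
  obtain ⟨x11, h11⟩ : ∃ x, a1 - a4 = x := ⟨_, rfl⟩
  obtain ⟨x12, h12⟩ : ∃ x, a4 - a3 = x := ⟨_, rfl⟩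
  obtain ⟨x13, h13⟩ : ∃ x, a1 + a2 + a3 = x := ⟨_, rfl⟩
  obtain ⟨x14, h14⟩ : ∃ x, a1 + a2 + a4 = x := ⟨_, rfl⟩
  obtain ⟨x15, h15⟩ : ∃ x, a2 + a3 + a4 = x := ⟨_, rfl⟩
  obtain ⟨x16, h16⟩ : ∃ x, a1 + a2 + a3 + a4 = x := ⟨_, rfl⟩
  obtain ⟨x17, h17⟩ : ∃ x, a1 + 2 * a2 + a3 = x := ⟨_, rfl⟩
  obtain ⟨x18, h18⟩ : ∃ x, a1 + 2 * a2 + a4 = x := ⟨_, rfl⟩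
  obtain ⟨x19, h19⟩ : ∃ x, 2 * a2 + a3 + a4 = x := ⟨_, rfl⟩
  obtain ⟨x20, h20⟩ : ∃ x, a1 + 2 * a2 + a3 + a4 = x := ⟨_, rfl⟩
  obtain ⟨x21, h21⟩ : ∃ x, 2 * a1 + 2 * a2 + a3 + a4 = x := ⟨_, rfl⟩
  obtain ⟨x22, h22⟩ : ∃ x, a1 + 2 * a2 + 2 * a3 + a4 = x := ⟨_, rfl⟩
  obtain ⟨x23, h23⟩ : ∃ x, a1 + 2 * a2 + a3 + 2 * a4 = x := ⟨_, rfl⟩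
  rw [R_of a1 a2 a3 a4 h0 h1 h2 h3 h4 h5 h6 h7 h8 h9 h10 h11 h12 h13 h14 h15 h16 h17 h18 h19 h20 h21 h22 h23,
    R_of (-a1 - 2 * a2 - a3 - a4) a2 a3 a4
      (show _ = -x20 by linarith)
      (show _ = x1 by linarith)
      (show _ = x2 by linarith)
      (show _ = x3 by linarith)
      (show _ = -x16 by linarith)
      (show _ = -x18 by linarith)
      (show _ = -x17 by linarith)
      (show _ = x7 by linarith)
      (show _ = x8 by linarith)
      (show _ = x9 by linarith)
      (show _ = -x22 by linarith)
      (show _ = -x23 by linarith)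
      (show _ = x12 by linarith)
      (show _ = -x14 by linarith)
      (show _ = -x13 by linarith)
      (show _ = x15 by linarith)
      (show _ = -x4 by linarith)
      (show _ = -x6 by linarith)
      (show _ = -x5 by linarith)
      (show _ = x19 by linarith)
      (show _ = -x0 by linarith)
      (show _ = -x21 by linarith)
      (show _ = -x10 by linarith)
      (show _ = -x11 by linarith)
    ]
  ring

open Polynomial in
/-- In the first variable, `R` is a polynomial of degree at most 15. -/
lemma R_poly (a2 a3 a4 : ℤ) : ∃ P : Polynomial ℤ, P.natDegree < 16 ∧
    ∀ a1, P.eval a1 = R a1 a2 a3 a4 := by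
  refine ⟨C ((a2) * (a3) * (a4) * (a2 + a3) * (a2 + a4) * (a3 + a4) * (a4 - a3) * (a2 + a3 + a4) * (2 * a2 + a3 + a4)) *
    ((X + C (0)) *(X + C (a2)) *(X + C (a3)) *(X + C (a4)) *(X + C (-a3)) *(X + C (-a4)) *(X + C (a2 + a3)) *(X + C (a2 + a4)) *(X + C (a2 + a3 + a4)) *(X + C (2 * a2 + a3)) *(X + C (2 * a2 + a4)) *(X + C (2 * a2 + a3 + a4)) *(2 * X + C (2 * a2 + a3 + a4)) *(X + C (2 * a2 + 2 * a3 + a4)) *(X + C (2 * a2 + a3 + 2 * a4))), ?_, ?_⟩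
  · refine Nat.lt_succ_of_le ?_
    compute_degree
  · intro a1
    simp only [eval_mul, eval_add, eval_C, eval_X, eval_ofNat]
    obtain ⟨x0, h0⟩ : ∃ x, a1 = x := ⟨_, rfl⟩
    obtain ⟨x1, h1⟩ : ∃ x, a2 = x := ⟨_, rfl⟩
    obtain ⟨x2, h2⟩ : ∃ x, a3 = x := ⟨_, rfl⟩
    obtain ⟨x3, h3⟩ : ∃ x, a4 = x := ⟨_, rfl⟩
    obtain ⟨x4, h4⟩ : ∃ x, a1 + a2 = x := ⟨_, rfl⟩
    obtain ⟨x5, h5⟩ : ∃ x, a1 + a3 = x := ⟨_, rfl⟩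
    obtain ⟨x6, h6⟩ : ∃ x, a1 + a4 = x := ⟨_, rfl⟩
    obtain ⟨x7, h7⟩ : ∃ x, a2 + a3 = x := ⟨_, rfl⟩
    obtain ⟨x8, h8⟩ : ∃ x, a2 + a4 = x := ⟨_, rfl⟩
    obtain ⟨x9, h9⟩ : ∃ x, a3 + a4 = x := ⟨_, rfl⟩
    obtain ⟨x10, h10⟩ : ∃ x, a1 - a3 = x := ⟨_, rfl⟩
    obtain ⟨x11, h11⟩ : ∃ x, a1 - a4 = x := ⟨_, rfl⟩
    obtain ⟨x12, h12⟩ : ∃ x, a4 - a3 = x := ⟨_, rfl⟩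
    obtain ⟨x13, h13⟩ : ∃ x, a1 + a2 + a3 = x := ⟨_, rfl⟩
    obtain ⟨x14, h14⟩ : ∃ x, a1 + a2 + a4 = x := ⟨_, rfl⟩
    obtain ⟨x15, h15⟩ : ∃ x, a2 + a3 + a4 = x := ⟨_, rfl⟩
    obtain ⟨x16, h16⟩ : ∃ x, a1 + a2 + a3 + a4 = x := ⟨_, rfl⟩
    obtain ⟨x17, h17⟩ : ∃ x, a1 + 2 * a2 + a3 = x := ⟨_, rfl⟩
    obtain ⟨x18, h18⟩ : ∃ x, a1 + 2 * a2 + a4 = x := ⟨_, rfl⟩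
    obtain ⟨x19, h19⟩ : ∃ x, 2 * a2 + a3 + a4 = x := ⟨_, rfl⟩
    obtain ⟨x20, h20⟩ : ∃ x, a1 + 2 * a2 + a3 + a4 = x := ⟨_, rfl⟩
    obtain ⟨x21, h21⟩ : ∃ x, 2 * a1 + 2 * a2 + a3 + a4 = x := ⟨_, rfl⟩
    obtain ⟨x22, h22⟩ : ∃ x, a1 + 2 * a2 + 2 * a3 + a4 = x := ⟨_, rfl⟩
    obtain ⟨x23, h23⟩ : ∃ x, a1 + 2 * a2 + a3 + 2 * a4 = x := ⟨_, rfl⟩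
    rw [R_of a1 a2 a3 a4 h0 h1 h2 h3 h4 h5 h6 h7 h8 h9 h10 h11 h12 h13 h14 h15 h16 h17 h18 h19 h20 h21 h22 h23]
    rw [show a1 + (0) = x0 by linarith
      , show a1 + (a2) = x4 by linarith
      , show a1 + (a3) = x5 by linarith
      , show a1 + (a4) = x6 by linarith
      , show a1 + (-a3) = x10 by linarith
      , show a1 + (-a4) = x11 by linarith
      , show a1 + (a2 + a3) = x13 by linarith
      , show a1 + (a2 + a4) = x14 by linarith
      , show a1 + (a2 + a3 + a4) = x16 by linarith
      , show a1 + (2 * a2 + a3) = x17 by linarith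
      , show a1 + (2 * a2 + a4) = x18 by linarith
      , show a1 + (2 * a2 + a3 + a4) = x20 by linarith
      , show 2 * a1 + (2 * a2 + a3 + a4) = x21 by linarith
      , show a1 + (2 * a2 + 2 * a3 + a4) = x22 by linarith
      , show a1 + (2 * a2 + a3 + 2 * a4) = x23 by linarith, h19, h15, h12, h9, h8, h7]
    rw [h1, h2, h3]
    ring

/-- Bounded universal quantification as a Boolean recursion. -/
def allLT (n : ℕ) (p : ℕ → Bool) : Bool :=
  Nat.rec true (fun i r => Bool.rec false r (p i)) n

lemma allLT_spec (n : ℕ) (p : ℕ → Bool) (h : allLT n p = true) : ∀ i < n, p i = true := by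
  induction n with
  | zero => intro i hi; omega
  | succ n ih =>
    have hb : Bool.rec false (allLT n p) (p n) = true := h
    intro i hi
    cases hp : p n with
    | false => rw [hp] at hb; cases hb
    | true =>
      rw [hp] at hb
      rcases Nat.lt_succ_iff_lt_or_eq.mp hi with h1 | h1
      · exact ih hb i h1
      · rw [h1, hp]

lemma gcd_dvd_of (m x : ℕ) (f w : ℤ) (h : f = x + m * w) : ((Nat.gcd x m : ℕ) : ℤ) ∣ f := by
  rw [h]
  exact dvd_add (Int.natCast_dvd_natCast.mpr (Nat.gcd_dvd_left x m))
    (Dvd.dvd.mul_right (Int.natCast_dvd_natCast.mpr (Nat.gcd_dvd_right x m)) w)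

/-- Product of the greatest common divisors of the factors with `m`. -/
def gN (m i j s t : ℕ) : ℕ :=
  (Nat.mul (Nat.mul (Nat.mul (Nat.mul (Nat.mul (Nat.mul (Nat.mul (Nat.mul (Nat.mul (Nat.mul (Nat.mul (Nat.mul (Nat.mul (Nat.mul (Nat.mul (Nat.mul (Nat.mul (Nat.mul (Nat.mul (Nat.mul (Nat.mul (Nat.mul (Nat.mul (Nat.gcd i m)
    (Nat.gcd j m))
    (Nat.gcd s m))
    (Nat.gcd t m))
    (Nat.gcd (Nat.add i j) m))
    (Nat.gcd (Nat.add i s) m))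
    (Nat.gcd (Nat.add i t) m))
    (Nat.gcd (Nat.add j s) m))
    (Nat.gcd (Nat.add j t) m))
    (Nat.gcd (Nat.add s t) m))
    (Nat.gcd (Nat.sub (Nat.add i m) s) m))
    (Nat.gcd (Nat.sub (Nat.add i m) t) m))
    (Nat.gcd (Nat.sub (Nat.add t m) s) m))
    (Nat.gcd (Nat.add (Nat.add i j) s) m))
    (Nat.gcd (Nat.add (Nat.add i j) t) m))
    (Nat.gcd (Nat.add (Nat.add j s) t) m))
    (Nat.gcd (Nat.add (Nat.add (Nat.add i j) s) t) m))
    (Nat.gcd (Nat.add (Nat.add (Nat.add i j) j) s) m))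
    (Nat.gcd (Nat.add (Nat.add (Nat.add i j) j) t) m))
    (Nat.gcd (Nat.add (Nat.add (Nat.add j j) s) t) m))
    (Nat.gcd (Nat.add (Nat.add (Nat.add (Nat.add i j) j) s) t) m))
    (Nat.gcd (Nat.add (Nat.add (Nat.add (Nat.add (Nat.add i i) j) j) s) t) m))
    (Nat.gcd (Nat.add (Nat.add (Nat.add (Nat.add (Nat.add i j) j) s) s) t) m))
    (Nat.gcd (Nat.add (Nat.add (Nat.add (Nat.add (Nat.add i j) j) s) t) t) m))

lemma gN_eq (m i j s t : ℕ) : gN m i j s t =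
    Nat.gcd (i) m *
    Nat.gcd (j) m *
    Nat.gcd (s) m *
    Nat.gcd (t) m *
    Nat.gcd (i + j) m *
    Nat.gcd (i + s) m *
    Nat.gcd (i + t) m *
    Nat.gcd (j + s) m *
    Nat.gcd (j + t) m *
    Nat.gcd (s + t) m *
    Nat.gcd (i + m - s) m *
    Nat.gcd (i + m - t) m *
    Nat.gcd (t + m - s) m *
    Nat.gcd (i + j + s) m *
    Nat.gcd (i + j + t) m *
    Nat.gcd (j + s + t) m *
    Nat.gcd (i + j + s + t) m *
    Nat.gcd (i + j + j + s) m *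
    Nat.gcd (i + j + j + t) m *
    Nat.gcd (j + j + s + t) m *
    Nat.gcd (i + j + j + s + t) m *
    Nat.gcd (i + i + j + j + s + t) m *
    Nat.gcd (i + j + j + s + s + t) m *
    Nat.gcd (i + j + j + s + t + t) m := rfl

lemma gN_dvd (m i j s t : ℕ) (hs : s ≤ m) (ht : t ≤ m) (a1 a2 a3 a4 u1 u2 u3 u4 : ℤ)
    (e1 : a1 = i + m * u1) (e2 : a2 = j + m * u2) (e3 : a3 = s + m * u3) (e4 : a4 = t + m * u4) :
    (gN m i j s t : ℤ) ∣ R a1 a2 a3 a4 := by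
  have c1 : ((i + m - s : ℕ) : ℤ) = i + m - s := by omega
  have c2 : ((i + m - t : ℕ) : ℤ) = i + m - t := by omega
  have c3 : ((t + m - s : ℕ) : ℤ) = t + m - s := by omega
  rw [gN_eq]
  simp only [Nat.cast_mul]
  unfold R
  refine mul_dvd_mul (mul_dvd_mul (mul_dvd_mul (mul_dvd_mul (mul_dvd_mul (mul_dvd_mul (mul_dvd_mul (mul_dvd_mul (mul_dvd_mul (mul_dvd_mul (mul_dvd_mul (mul_dvd_mul (mul_dvd_mul (mul_dvd_mul (mul_dvd_mul (mul_dvd_mul (mul_dvd_mul (mul_dvd_mul (mul_dvd_mul (mul_dvd_mul (mul_dvd_mul (mul_dvd_mul (mul_dvd_mul ?_ ?_) ?_) ?_) ?_) ?_) ?_) ?_) ?_) ?_) ?_) ?_) ?_) ?_) ?_) ?_) ?_) ?_) ?_) ?_) ?_) ?_) ?_) ?_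
  · refine gcd_dvd_of m _ _ (u1) ?_
    rw [e1]
  · refine gcd_dvd_of m _ _ (u2) ?_
    rw [e2]
  · refine gcd_dvd_of m _ _ (u3) ?_
    rw [e3]
  · refine gcd_dvd_of m _ _ (u4) ?_
    rw [e4]
  · refine gcd_dvd_of m _ _ (u1 + u2) ?_
    rw [e1, e2]
    push_cast; ring
  · refine gcd_dvd_of m _ _ (u1 + u3) ?_
    rw [e1, e3]
    push_cast; ring
  · refine gcd_dvd_of m _ _ (u1 + u4) ?_
    rw [e1, e4]
    push_cast; ring
  · refine gcd_dvd_of m _ _ (u2 + u3) ?_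
    rw [e2, e3]
    push_cast; ring
  · refine gcd_dvd_of m _ _ (u2 + u4) ?_
    rw [e2, e4]
    push_cast; ring
  · refine gcd_dvd_of m _ _ (u3 + u4) ?_
    rw [e3, e4]
    push_cast; ring
  · refine gcd_dvd_of m _ _ (u1 - u3 - 1) ?_
    rw [e1, e3, c1]
    push_cast; ring
  · refine gcd_dvd_of m _ _ (u1 - u4 - 1) ?_
    rw [e1, e4, c2]
    push_cast; ring
  · refine gcd_dvd_of m _ _ (u4 - u3 - 1) ?_
    rw [e3, e4, c3]
    push_cast; ring
  · refine gcd_dvd_of m _ _ (u1 + u2 + u3) ?_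
    rw [e1, e2, e3]
    push_cast; ring
  · refine gcd_dvd_of m _ _ (u1 + u2 + u4) ?_
    rw [e1, e2, e4]
    push_cast; ring
  · refine gcd_dvd_of m _ _ (u2 + u3 + u4) ?_
    rw [e2, e3, e4]
    push_cast; ring
  · refine gcd_dvd_of m _ _ (u1 + u2 + u3 + u4) ?_
    rw [e1, e2, e3, e4]
    push_cast; ring
  · refine gcd_dvd_of m _ _ (u1 + 2 * u2 + u3) ?_
    rw [e1, e2, e3]
    push_cast; ring
  · refine gcd_dvd_of m _ _ (u1 + 2 * u2 + u4) ?_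
    rw [e1, e2, e4]
    push_cast; ring
  · refine gcd_dvd_of m _ _ (2 * u2 + u3 + u4) ?_
    rw [e2, e3, e4]
    push_cast; ring
  · refine gcd_dvd_of m _ _ (u1 + 2 * u2 + u3 + u4) ?_
    rw [e1, e2, e3, e4]
    push_cast; ring
  · refine gcd_dvd_of m _ _ (2 * u1 + 2 * u2 + u3 + u4) ?_
    rw [e1, e2, e3, e4]
    push_cast; ring
  · refine gcd_dvd_of m _ _ (u1 + 2 * u2 + 2 * u3 + u4) ?_
    rw [e1, e2, e3, e4]
    push_cast; ring
  · refine gcd_dvd_of m _ _ (u1 + 2 * u2 + u3 + 2 * u4) ?_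
    rw [e1, e2, e3, e4]
    push_cast; ring

/-- The finite check modulo `m`. -/
def check (m q : ℕ) : Bool :=
  allLT m fun i => allLT m fun j => allLT m fun s => allLT m fun t =>
    Nat.beq (Nat.mod (gN m i j s t) q) 0

/-- Reduction of a divisibility of `R` to a finite check modulo `m`. -/
lemma dvd_R_of_check (m q : ℕ) (hm : 0 < m) (h : check m q = true)
    (a1 a2 a3 a4 : ℤ) : (q : ℤ) ∣ R a1 a2 a3 a4 := by
  have key : ∀ a : ℤ, ∃ i < m, ∃ w, a = (i : ℕ) + (m : ℤ) * w := fun a => by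
    have h1 := Int.emod_nonneg a (b := (m : ℤ)) (by omega)
    have h2 := Int.emod_lt_of_pos a (b := (m : ℤ)) (by omega)
    refine ⟨(a % (m : ℤ)).toNat, by omega, a / m, ?_⟩
    rw [Int.toNat_of_nonneg h1, Int.emod_add_mul_ediv]
  obtain ⟨i, hi, u1, e1⟩ := key a1
  obtain ⟨j, hj, u2, e2⟩ := key a2
  obtain ⟨s, hs, u3, e3⟩ := key a3
  obtain ⟨t, ht, u4, e4⟩ := key a4
  have h1 := allLT_spec _ _ (allLT_spec _ _ (allLT_spec _ _ (allLT_spec _ _ h i hi) j hj) s hs) t ht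
  have h2 : gN m i j s t % q = 0 := Nat.eq_of_beq_eq_true h1
  refine dvd_trans (Int.natCast_dvd_natCast.mpr (Nat.dvd_of_mod_eq_zero h2)) ?_
  exact gN_dvd m i j s t hs.le ht.le a1 a2 a3 a4 u1 u2 u3 u4 e1 e2 e3 e4

lemma dvd_two (a1 a2 a3 a4 : ℤ) : (2 ^ 15 : ℤ) ∣ R a1 a2 a3 a4 := by
  have h := dvd_R_of_check 8 32768 (by norm_num) (by decide +kernel) a1 a2 a3 a4
  norm_num at h ⊢
  exact h

lemma dvd_three (a1 a2 a3 a4 : ℤ) : (3 ^ 7 : ℤ) ∣ R a1 a2 a3 a4 := by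
  have h := dvd_R_of_check 9 2187 (by norm_num) (by decide +kernel) a1 a2 a3 a4
  norm_num at h ⊢
  exact h

lemma dvd_five (a1 a2 a3 a4 : ℤ) : (5 ^ 4 : ℤ) ∣ R a1 a2 a3 a4 := by
  have h := dvd_R_of_check 5 625 (by norm_num) (by decide +kernel) a1 a2 a3 a4
  norm_num at h ⊢
  exact h

lemma dvd_seven (a1 a2 a3 a4 : ℤ) : (7 ^ 2 : ℤ) ∣ R a1 a2 a3 a4 := by
  have h := dvd_R_of_check 7 49 (by norm_num) (by decide +kernel) a1 a2 a3 a4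
  norm_num at h ⊢
  exact h

lemma dvd_eleven (a1 a2 a3 a4 : ℤ) : (11 : ℤ) ∣ R a1 a2 a3 a4 := by
  have h := dvd_R_of_check 11 11 (by norm_num) (by decide +kernel) a1 a2 a3 a4
  norm_num at h ⊢
  exact h

/-- Integrality of the formal Weyl dimension. -/
lemma Nf4_dvd (a1 a2 a3 a4 : ℤ) : Nf4 ∣ R a1 a2 a3 a4 := by
  unfold Nf4
  refine IsCoprime.mul_dvd (by norm_num) (IsCoprime.mul_dvd (by norm_num) (IsCoprime.mul_dvd
    (by norm_num) (IsCoprime.mul_dvd (by norm_num) ?_ ?_) ?_) ?_) ?_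
  · exact dvd_two ..
  · exact dvd_three ..
  · exact dvd_five ..
  · exact dvd_seven ..
  · exact dvd_eleven ..

lemma choose_dvd (k j : ℕ) (hj : j < 15) (M : ℤ)
    (hM : M = ((k + 12 : ℕ) : ℤ) / (Int.gcd ((k + 12 : ℕ) : ℤ) 27720 : ℤ)) :
    M ∣ 13 * ((k + 12).choose (j + 1) : ℤ) := by
  have h1 := Nat.add_one_mul_choose_eq (k + 11) j
  have h2 : j + 1 ∣ 13 * 27720 := by interval_cases j <;> decide
  obtain ⟨d, hd⟩ := h2
  have hgpos : 0 < Nat.gcd (k + 12) 27720 := Nat.gcd_pos_of_pos_right _ (by norm_num)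
  obtain ⟨m, c, hcop, hm, hc⟩ := Nat.exists_coprime (k + 12) 27720
  have hg : Int.gcd ((k + 12 : ℕ) : ℤ) 27720 = Nat.gcd (k + 12) 27720 := rfl
  have hMm : M = (m : ℤ) := by
    rw [hM, hg, ← Int.natCast_div]
    congr 1
    exact Nat.div_eq_of_eq_mul_left hgpos hm
  generalize Nat.gcd (k + 12) 27720 = g at *
  rw [hMm]
  have h3 : m ∣ 13 * (k + 12).choose (j + 1) := by
    refine Nat.Coprime.dvd_of_dvd_mul_left hcop ?_
    refine ⟨(k + 11).choose j * d, ?_⟩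
    apply Nat.eq_of_mul_eq_mul_left hgpos
    have hchoose : (k + 12) * (k + 11).choose j = (k + 12).choose (j + 1) * (j + 1) := h1
    calc g * (c * (13 * (k + 12).choose (j + 1)))
        = (13 * (c * g)) * (k + 12).choose (j + 1) := by ring
      _ = ((k + 12).choose (j + 1) * (j + 1)) * d := by rw [← hc, hd]; ring
      _ = (m * g) * (k + 11).choose j * d := by rw [← hchoose, ← hm]
      _ = g * (m * ((k + 11).choose j * d)) := by ring
  exact_mod_cast h3

open fwdDiff in
lemma shift_dvd (k : ℕ) (M : ℤ)
    (hM : M = ((k + 12 : ℕ) : ℤ) / (Int.gcd ((k + 12 : ℕ) : ℤ) 27720 : ℤ))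
    (a1 a2 a3 a4 : ℤ) :
    Nf4 * M ∣ R (a1 + (k + 12 : ℕ)) a2 a3 a4 - R a1 a2 a3 a4 := by
  obtain ⟨P, hP, hPR⟩ := R_poly a2 a3 a4
  have hN0 : Nf4 ≠ 0 := by norm_num [Nf4]
  choose f hf using fun a => Nf4_dvd a a2 a3 a4
  have hΔ : ∀ j, 16 ≤ j → ∀ y, (fwdDiff (1 : ℤ))^[j] f y = 0 := by
    intro j hj y
    have h1 := Polynomial.fwdDiff_iter_eq_zero_of_degree_lt (P := P) (n := j) (by omega)
    have h2 : P.eval = Nf4 • f := by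
      funext a
      simp [hPR, hf]
    rw [h2, fwdDiff_iter_const_smul] at h1
    have h3 := congrFun h1 y
    simpa [hN0] using h3
  have h13 : M ∣ 13 * (f (a1 + (k + 12 : ℕ)) - f a1) := by
    have := shift_eq_sum_fwdDiff_iter (1 : ℤ) f (k + 12) a1
    rw [nsmul_one] at this
    rw [this, Finset.sum_range_succ']
    simp only [Nat.choose_zero_right, Function.iterate_zero, id, one_smul, add_sub_cancel_right]
    rw [Finset.mul_sum]
    refine Finset.dvd_sum fun j _ => ?_
    by_cases hj : j < 15
    · rw [nsmul_eq_mul, ← mul_assoc]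
      exact Dvd.dvd.mul_right (choose_dvd k j hj M hM) _
    · rw [hΔ (j + 1) (by omega)]
      simp
  have hK : M ∣ Nf4 * (f (a1 + (k + 12 : ℕ)) - f a1) := by
    have h1 : M ∣ ((k + 12 : ℕ) : ℤ) := by
      rw [hM]
      exact Int.ediv_dvd_of_dvd (Int.gcd_dvd_left _ _)
    refine h1.trans ?_
    rw [mul_sub, ← hf, ← hf, ← hPR, ← hPR]
    have := P.sub_dvd_eval_sub (a1 + (k + 12 : ℕ)) a1
    simpa using this
  rw [hf, hf, ← mul_sub]
  refine mul_dvd_mul_left _ ?_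
  have hcop : IsCoprime (13 : ℤ) Nf4 := by norm_num [Nf4]
  obtain ⟨u, v, huv⟩ := hcop
  have := dvd_add (Dvd.dvd.mul_left h13 u) (Dvd.dvd.mul_left hK v)
  rwa [← mul_assoc, ← mul_assoc, ← add_mul, huv, one_mul] at this

/-- Replacing the first label by the zeroth one changes the sign modulo `N M`. -/
lemma core (k : ℕ) (M : ℤ)
    (hM : M = ((k + 12 : ℕ) : ℤ) / (Int.gcd ((k + 12 : ℕ) : ℤ) 27720 : ℤ))
    (a0 a1 a2 a3 a4 : ℤ) (h0 : a0 = ((k + 12 : ℕ) : ℤ) - a1 - 2 * a2 - a3 - a4) :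
    Nf4 * M ∣ R a0 a2 a3 a4 + R a1 a2 a3 a4 := by
  have h1 := R_refl a1 a2 a3 a4
  have h2 := shift_dvd k M hM (-a1 - 2 * a2 - a3 - a4) a2 a3 a4
  have h3 : -a1 - 2 * a2 - a3 - a4 + ((k + 12 : ℕ) : ℤ) = a0 := by rw [h0]; ring
  rwa [h1, h3, sub_neg_eq_add] at h2

/-- The formal `F₄` Weyl dimension is invariant mod `M_{F₄}` under each of the
three nontrivial simple currents `J_ν`, `J_s`, `J_ν J_s` of `D₄`, acting on the
shifted Dynkin labels by `(a1,a2,a3,a4) ↦ (a0,a2,a4,a3)`, `(a3,a2,a1,a0)`,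
`(a4,a2,a0,a1)` respectively, where `a0 = K - a1 - 2a2 - a3 - a4`. -/
theorem F4_dim_invariant_under_D4_simple_currents (k : ℕ) (K M : ℤ)
    (hK : K = (k : ℤ) + 12) (hM : M = K / (Int.gcd K 27720 : ℤ)) :
    ∀ a1 a2 a3 a4 : ℤ, ∀ a0 : ℤ, a0 = K - a1 - 2 * a2 - a3 - a4 →
      (Nf4 * M ∣ R a0 a2 a4 a3 - R a1 a2 a3 a4) ∧
      (Nf4 * M ∣ R a3 a2 a1 a0 - R a1 a2 a3 a4) ∧
      (Nf4 * M ∣ R a4 a2 a0 a1 - R a1 a2 a3 a4) := by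
  intro a1 a2 a3 a4 a0 h0
  have hKn : K = ((k + 12 : ℕ) : ℤ) := by rw [hK]; push_cast; ring
  rw [hKn] at hM h0
  refine ⟨?_, ?_, ?_⟩
  · have h := core k M hM a0 a1 a2 a3 a4 h0
    have e : R a0 a2 a4 a3 - R a1 a2 a3 a4 = -(R a0 a2 a3 a4 + R a1 a2 a3 a4) := by
      linarith [R_swap13 a4 a2 a0 a3, R_swap14 a4 a2 a0 a3, R_swap13 a3 a2 a0 a4]
    rwa [e, dvd_neg]
  · have h := core k M hM a0 a4 a2 a3 a1 (by rw [h0]; ring)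
    have e : R a3 a2 a1 a0 - R a1 a2 a3 a4 = R a0 a2 a3 a1 + R a4 a2 a3 a1 := by
      linarith [R_swap13 a1 a2 a3 a0, R_swap14 a1 a2 a3 a0, R_swap14 a1 a2 a3 a4]
    rwa [e]
  · have h := core k M hM a0 a3 a2 a1 a4 (by rw [h0]; ring)
    have e : R a4 a2 a0 a1 - R a1 a2 a3 a4 = R a0 a2 a1 a4 + R a3 a2 a1 a4 := by
      linarith [R_swap14 a1 a2 a0 a4, R_swap13 a1 a2 a0 a4, R_swap13 a1 a2 a3 a4]
    rwa [e]
end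

section
/- Let K, L, N be positive integers and set M := K/gcd(K,L). Let n be a natural number and let f_1,...,f_n and d_1,...,d_n be integers such that N divides the product f_1·f_2···f_n and N divides the product (f_1-d_1·K)·(f_2-d_2·K)···(f_n-d_n·K). Assume that for every prime p dividing M whose p-adic valuation ν_p(N) of N strictly exceeds the p-adic valuation ν_p(L) of L, there exist natural numbers α_1,...,α_n with α_i ≤ ν_p(L) for each i, p^{α_i} dividing f_i for each i, and α_1 + ... + α_n ≥ ν_p(N). Then (f_1···f_n)/N ≡ ((f_1-d_1·K)···(f_n-d_n·K))/N (mod M). -/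
/-- **Fact 1.** Let `K, L, N` be positive integers and `M = K / gcd(K, L)`.
Given integers `f i` and `d i` such that `N` divides both `∏ i, f i` and
`∏ i, (f i - d i * K)`, and such that for every prime `p` dividing `M` with
`ν_p(N) > ν_p(L)` one can find `α i ≤ ν_p(L)` with `p^(α i) ∣ f i` and
`∑ i, α i ≥ ν_p(N)`, the two quotients by `N` are congruent mod `M`. -/
theorem quotient_congruence_fact (K L N : ℕ) (hK : 0 < K) (hL : 0 < L) (hN : 0 < N)
    (M : ℕ) (hM : M = K / Nat.gcd K L)
    (n : ℕ) (f d : Fin n → ℤ)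
    (hf : (N : ℤ) ∣ ∏ i, f i)
    (hfd : (N : ℤ) ∣ ∏ i, (f i - d i * (K : ℤ)))
    (hprime : ∀ p : ℕ, p.Prime → p ∣ M → L.factorization p < N.factorization p →
      ∃ α : Fin n → ℕ, (∀ i, α i ≤ L.factorization p) ∧
        (∀ i, (p : ℤ) ^ (α i) ∣ f i) ∧ N.factorization p ≤ ∑ i, α i) :
    (∏ i, f i) / (N : ℤ) ≡ (∏ i, (f i - d i * (K : ℤ))) / (N : ℤ) [ZMOD (M : ℤ)] := by
  have hM0 : M ≠ 0 := by
    rw [hM]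
    exact (Nat.div_pos (Nat.gcd_le_left L hK) (Nat.gcd_pos_of_pos_left L hK)).ne'
  have hprod : ∀ (g h : Fin n → ℤ) (m : ℤ), (∀ i, m ∣ g i - h i) →
      m ∣ ∏ i, g i - ∏ i, h i := by
    intro g h m H
    apply Int.ModEq.dvd
    apply Int.ModEq.prod
    intro i _
    exact (Int.modEq_iff_dvd.mpr (H i))
  have key : ((M * N : ℕ) : ℤ) ∣ ∏ i, f i - ∏ i, (f i - d i * (K : ℤ)) := by
    rw [Int.natCast_dvd, Nat.dvd_iff_prime_pow_dvd_dvd]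
    intro p j hp hj
    rw [← Int.natCast_dvd]
    have hj' : j ≤ M.factorization p + N.factorization p := by
      have h1 := (hp.pow_dvd_iff_le_factorization (Nat.mul_ne_zero hM0 hN.ne')).mp hj
      rwa [Nat.factorization_mul hM0 hN.ne'] at h1
    have hMf : M.factorization p
        = K.factorization p - min (K.factorization p) (L.factorization p) := by
      rw [hM, Nat.factorization_div (Nat.gcd_dvd_left K L),
        Nat.factorization_gcd hK.ne' hL.ne']
      simp
    have hNdvd : ((p ^ N.factorization p : ℕ) : ℤ) ∣ (N : ℤ) :=
      Int.natCast_dvd_natCast.mpr (Nat.ordProj_dvd N p)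
    have hKdvd : ((p ^ K.factorization p : ℕ) : ℤ) ∣ (K : ℤ) :=
      Int.natCast_dvd_natCast.mpr (Nat.ordProj_dvd K p)
    have le_dvd : ∀ {a b : ℕ}, a ≤ b → ((p ^ a : ℕ) : ℤ) ∣ ((p ^ b : ℕ) : ℤ) :=
      fun h => Int.natCast_dvd_natCast.mpr (pow_dvd_pow p h)
    by_cases hpM : p ∣ M
    · have hpos : 0 < M.factorization p := hp.factorization_pos_of_dvd hM0 hpM
      by_cases hlt : L.factorization p < N.factorization p
      · obtain ⟨α, h1, h2, h3⟩ := hprime p hp hpM hlt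
        choose g hg using h2
        obtain ⟨c, hc⟩ := hKdvd
        have hfac : ∀ i, f i - d i * (K : ℤ)
            = (p : ℤ) ^ α i * (g i - d i * c * (p : ℤ) ^ (K.factorization p - α i)) := by
          intro i
          have h4 : (p : ℤ) ^ K.factorization p
              = (p : ℤ) ^ α i * (p : ℤ) ^ (K.factorization p - α i) := by
            rw [← pow_add]
            congr 1
            have := h1 i
            omega
          rw [hc, hg i]
          push_cast
          rw [h4]
          ring
        have e1 : ∏ i, f i = (p : ℤ) ^ (∑ i, α i) * ∏ i, g i := by
          rw [← Finset.prod_pow_eq_pow_sum, ← Finset.prod_mul_distrib]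
          exact Finset.prod_congr rfl fun i _ => hg i
        have e2 : ∏ i, (f i - d i * (K : ℤ)) = (p : ℤ) ^ (∑ i, α i) *
            ∏ i, (g i - d i * c * (p : ℤ) ^ (K.factorization p - α i)) := by
          rw [← Finset.prod_pow_eq_pow_sum, ← Finset.prod_mul_distrib]
          exact Finset.prod_congr rfl fun i _ => hfac i
        rw [e1, e2, ← mul_sub]
        have h5 := hprod g (fun i => g i - d i * c * (p : ℤ) ^ (K.factorization p - α i))
          ((p : ℤ) ^ M.factorization p) (by
            intro i
            rw [sub_sub_cancel]
            apply Dvd.dvd.mul_left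
            apply pow_dvd_pow
            have := h1 i
            omega)
        refine dvd_trans ?_ (mul_dvd_mul_left _ h5)
        rw [← pow_add]
        push_cast
        apply pow_dvd_pow
        omega
      · refine dvd_trans (dvd_trans (le_dvd (by omega)) hKdvd) (hprod _ _ _ fun i => ?_)
        rw [sub_sub_cancel]
        exact dvd_mul_left _ _
    · have h0 : M.factorization p = 0 := Nat.factorization_eq_zero_of_not_dvd hpM
      exact dvd_trans (dvd_trans (le_dvd (by omega)) hNdvd) (dvd_sub hf hfd)
  obtain ⟨a, ha⟩ := hf
  obtain ⟨b, hb⟩ := hfd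
  have hN' : (N : ℤ) ≠ 0 := by exact_mod_cast hN.ne'
  rw [ha, hb] at key ⊢
  rw [Int.mul_ediv_cancel_left _ hN', Int.mul_ediv_cancel_left _ hN']
  apply Int.ModEq.symm
  apply Int.modEq_iff_dvd.mpr
  rw [← mul_sub, Nat.cast_mul, mul_comm (M : ℤ)] at key
  exact (mul_dvd_mul_iff_left hN').mp key
end
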